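/- arXiv:2503.08172 — 3 statements merged into one kernel-verified Lean document; each statement's English description precedes it below -/
import Mathlib

section
/- Let s ∈ (0,2) ∪ (2,∞), and let T and u* be the explicit functions: for s ∈ (0,2), Δ = √(s(2−s)), u* = (2/Δ)·arctan(√((2−s)/s)), T(u) = (2/s)·tan(uΔ/2)/(√((2−s)/s) − tan(uΔ/2)); for s ∈ (2,∞), δ = √(s(s−2)), u* = (1/δ)·log(s−1+δ), T(u) = (2/s)·δe^{uδ}/(s−1+δ−e^{uδ}). Then lim_{u→u*⁻} (u*−u)·T(u) = 2/s and lim_{u→u*⁻} (u*−u)²·T′(u) = 2/s. -/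
open Filter

/-- If `f` has a continuous nonvanishing derivative `f'` near `a`, then `k f / (f a - f)` has a
simple pole at `a` with leading coefficient `k f(a) / f'(a)`, and its derivative has the
corresponding double pole. -/
theorem tendsto_simple_pole {f f' T : ℝ → ℝ} {a k : ℝ}
    (hf : ∀ᶠ u in nhds a, HasDerivAt f (f' u) u) (hf' : ContinuousAt f' a) (ha : f' a ≠ 0)
    (hT : ∀ u, T u = k * f u / (f a - f u)) :
    Tendsto (fun u => (a - u) * T u) (nhdsWithin a {a}ᶜ) (nhds (k * f a / f' a)) ∧
    Tendsto (fun u => (a - u) ^ 2 * deriv T u) (nhdsWithin a {a}ᶜ)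
      (nhds (k * f a / f' a)) := by
  have hfa : HasDerivAt f (f' a) a := hf.self_of_nhds
  have hratio : Tendsto (fun u => (a - u) / (f a - f u)) (nhdsWithin a {a}ᶜ)
      (nhds (f' a)⁻¹) := by
    refine (hfa.tendsto_slope.inv₀ ha).congr fun u => ?_
    rw [slope_def_field, inv_div, ← neg_sub a u, ← neg_sub (f a) (f u), neg_div_neg_eq]
  have hfc : Tendsto f (nhdsWithin a {a}ᶜ) (nhds (f a)) :=
    hfa.continuousAt.tendsto.mono_left nhdsWithin_le_nhds
  have hfc' : Tendsto f' (nhdsWithin a {a}ᶜ) (nhds (f' a)) :=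
    hf'.tendsto.mono_left nhdsWithin_le_nhds
  constructor
  · rw [div_eq_mul_inv]
    refine ((hfc.const_mul k).mul hratio).congr fun u => ?_
    rw [hT]
    ring
  · have hlim := ((hfc'.const_mul (k * f a)).mul (hratio.pow 2))
    have hval : k * f a * f' a * (f' a)⁻¹ ^ 2 = k * f a / f' a := by
      field_simp
    rw [hval] at hlim
    refine hlim.congr' ?_
    filter_upwards [hf.filter_mono nhdsWithin_le_nhds, hfa.eventually_ne (c := f a) ha]
      with u hu hne
    have hsub : f a - f u ≠ 0 := sub_ne_zero.2 (Ne.symm hne)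
    have hd : HasDerivAt T
        ((k * f' u * (f a - f u) - k * f u * -f' u) / (f a - f u) ^ 2) u := by
      rw [funext hT]
      exact (hu.const_mul k).div (hu.const_sub (f a)) hsub
    rw [hd.deriv]
    field_simp
    ring

/-- Behaviour at the singularity `u*` of the explicit solution `T` of the Riccati
equation `T′ = 1 + s T + (s/2) T²`, `T(0) = 0`:
`lim_{u→u*⁻} (u*-u) T(u) = 2/s` and `lim_{u→u*⁻} (u*-u)² T′(u) = 2/s`. -/
theorem riccati_singularity_asymptotics (s : ℝ)
    (hs : s ∈ Set.Ioo (0 : ℝ) 2 ∪ Set.Ioi (2 : ℝ))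
    (T : ℝ → ℝ) (ustar : ℝ)
    (hlt : s < 2 →
      ustar = 2 / Real.sqrt (s * (2 - s)) * Real.arctan (Real.sqrt ((2 - s) / s)) ∧
      ∀ u : ℝ, T u = 2 / s * Real.tan (u * Real.sqrt (s * (2 - s)) / 2) /
        (Real.sqrt ((2 - s) / s) - Real.tan (u * Real.sqrt (s * (2 - s)) / 2)))
    (hgt : 2 < s →
      ustar = 1 / Real.sqrt (s * (s - 2)) * Real.log (s - 1 + Real.sqrt (s * (s - 2))) ∧
      ∀ u : ℝ, T u = 2 / s *
        (Real.sqrt (s * (s - 2)) * Real.exp (u * Real.sqrt (s * (s - 2)))) /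
        (s - 1 + Real.sqrt (s * (s - 2)) - Real.exp (u * Real.sqrt (s * (s - 2))))) :
    Tendsto (fun u => (ustar - u) * T u) (nhdsWithin ustar (Set.Iio ustar))
      (nhds (2 / s)) ∧
    Tendsto (fun u => (ustar - u) ^ 2 * deriv T u) (nhdsWithin ustar (Set.Iio ustar))
      (nhds (2 / s)) := by
  have hleft : nhdsWithin ustar (Set.Iio ustar) ≤ nhdsWithin ustar {ustar}ᶜ :=
    nhdsWithin_mono _ fun u hu => ne_of_lt hu
  rcases hs with ⟨hs0, hs2⟩ | hs2
  · obtain ⟨hu, hT⟩ := hlt hs2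
    have hD : 0 < Real.sqrt (s * (2 - s)) := Real.sqrt_pos.2 (mul_pos hs0 (sub_pos.2 hs2))
    have hc2 : Real.sqrt ((2 - s) / s) ^ 2 = (2 - s) / s :=
      Real.sq_sqrt (div_nonneg (sub_pos.2 hs2).le hs0.le)
    have hcD : Real.sqrt (s * (2 - s)) = s * Real.sqrt ((2 - s) / s) := by
      rw [Real.sqrt_eq_iff_mul_self_eq (mul_pos hs0 (sub_pos.2 hs2)).le (by positivity)]
      have : s * Real.sqrt ((2 - s) / s) * (s * Real.sqrt ((2 - s) / s)) =
          s ^ 2 * Real.sqrt ((2 - s) / s) ^ 2 := by ring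
      rw [this, hc2]
      field_simp
    set D := Real.sqrt (s * (2 - s))
    set c := Real.sqrt ((2 - s) / s)
    have harg : ustar * D / 2 = Real.arctan c := by
      rw [hu]
      field_simp
    have htan : Real.tan (ustar * D / 2) = c := by rw [harg, Real.tan_arctan]
    have hcos : Real.cos (ustar * D / 2) ≠ 0 := by
      rw [harg]
      exact (Real.cos_arctan_pos c).ne'
    have hcont : Continuous fun u : ℝ => Real.cos (u * D / 2) := by fun_prop
    have hderiv : ∀ᶠ u in nhds ustar, HasDerivAt (fun u => Real.tan (u * D / 2))
        (1 / Real.cos (u * D / 2) ^ 2 * (D / 2)) u := by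
      filter_upwards [hcont.continuousAt.eventually_ne hcos] with u hu
      have hlin : HasDerivAt (fun u : ℝ => u * D / 2) (D / 2) u := by
        simpa using ((hasDerivAt_id u).mul_const D).div_const 2
      exact (Real.hasDerivAt_tan hu).comp u hlin
    have hval : 1 / Real.cos (ustar * D / 2) ^ 2 * (D / 2) = c := by
      rw [harg, Real.cos_sq_arctan, hc2, hcD]
      field_simp
      ring
    have hc : c ≠ 0 := by
      rintro h
      rw [hcD, h, mul_zero] at hD
      exact hD.false
    have key := tendsto_simple_pole (T := T) (k := 2 / s) hderiv
      (((continuousAt_const.div (hcont.continuousAt.pow 2) (pow_ne_zero 2 hcos)).mul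
        continuousAt_const)) (by rw [hval]; exact hc) (by intro u; rw [hT, htan])
    rw [hval, htan, mul_div_cancel_right₀ _ hc] at key
    exact ⟨key.1.mono_left hleft, key.2.mono_left hleft⟩
  · obtain ⟨hu, hT⟩ := hgt hs2
    have hs2' : 2 < s := hs2
    have hD : 0 < Real.sqrt (s * (s - 2)) := Real.sqrt_pos.2 (by nlinarith)
    set D := Real.sqrt (s * (s - 2))
    have hexp : Real.exp (ustar * D) = s - 1 + D := by
      have harg : ustar * D = Real.log (s - 1 + D) := by
        rw [hu]
        field_simp
      rw [harg, Real.exp_log (by linarith)]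
    have hderiv : ∀ u : ℝ, HasDerivAt (fun u => Real.exp (u * D)) (Real.exp (u * D) * D) u := by
      intro u
      simpa using ((hasDerivAt_id u).mul_const D).exp
    have hcont : Continuous fun u : ℝ => Real.exp (u * D) * D := by fun_prop
    have key := tendsto_simple_pole (T := T) (k := 2 / s * D)
      (Eventually.of_forall hderiv : ∀ᶠ u in nhds ustar, _) hcont.continuousAt
      (mul_pos (Real.exp_pos _) hD).ne' (by intro u; rw [hT, hexp, mul_assoc])
    have hval : 2 / s * D * Real.exp (ustar * D) / (Real.exp (ustar * D) * D) = 2 / s := by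
      field_simp
    rw [hval] at key
    exact ⟨key.1.mono_left hleft, key.2.mono_left hleft⟩
end

section
/- Let α, β > 0, γ = (α+β)/2, and let A : ℤ × ℤ → ℝ be the weighted adjacency matrix with A(0,1) = α, A(0,−1) = β, A(x,x+1) = A(x,x−1) = 1 for all x ≠ 0, and A(x,y) = 0 otherwise. (i) If γ < 1, then the function ψ(x) = 1 + (1/γ − 1)·|x| is positive on ℤ and satisfies Σ_{y∈ℤ} A(x,y)ψ(y) = 2·ψ(x) for all x ∈ ℤ. (ii) If γ > 1, then setting s = (1/2)·√(1 − (1 − 1/γ)²), ρ = 1/s and q = 1/(2γs), one has 0 < q < 1, and the function ψ(x) = q^{|x|} satisfies Σ_{y∈ℤ} A(x,y)ψ(y) = ρ·ψ(x) for all x ∈ ℤ. -/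
/-- The action of the weighted adjacency matrix on an even function `y ↦ g |y|`: if
`(α + β) g(1) = c g(0)` and `g(n) + g(n+2) = c g(n+1)`, then `g |·|` is an eigenfunction
with eigenvalue `c`. -/
theorem hasSum_weighted_adjacency_of_recurrence {α β c : ℝ} {A : ℤ → ℤ → ℝ} {g : ℕ → ℝ}
    (hA : ∀ x y : ℤ, A x y =
      if x = 0 ∧ y = 1 then α
      else if x = 0 ∧ y = -1 then β
      else if x ≠ 0 ∧ (y = x + 1 ∨ y = x - 1) then 1
      else 0)
    (h0 : (α + β) * g 1 = c * g 0) (hsucc : ∀ n, g n + g (n + 2) = c * g (n + 1)) (x : ℤ) :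
    HasSum (fun y : ℤ => A x y * g y.natAbs) (c * g x.natAbs) := by
  have hsum : HasSum (fun y : ℤ => A x y * g y.natAbs)
      (∑ y ∈ {x + 1, x - 1}, A x y * g y.natAbs) := by
    refine hasSum_sum_of_ne_finset_zero fun y hy => ?_
    simp only [Finset.mem_insert, Finset.mem_singleton, not_or] at hy
    rw [hA, if_neg (by omega), if_neg (by omega), if_neg (by omega), zero_mul]
  rw [Finset.sum_pair (by omega)] at hsum
  convert hsum using 1
  rcases eq_or_ne x 0 with rfl | hx
  · simp only [hA]
    norm_num
    linarith
  · have hup : A x (x + 1) = 1 := by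
      rw [hA, if_neg (by omega), if_neg (by omega), if_pos (by omega)]
    have hdown : A x (x - 1) = 1 := by
      rw [hA, if_neg (by omega), if_neg (by omega), if_pos (by omega)]
    rw [hup, hdown, one_mul, one_mul]
    obtain ⟨n, hn⟩ : ∃ n, x.natAbs = n + 1 := ⟨x.natAbs - 1, by omega⟩
    rw [hn, ← hsucc]
    rcases hx.lt_or_gt with hneg | hpos
    · rw [show (x + 1).natAbs = n by omega, show (x - 1).natAbs = n + 2 by omega]
    · rw [show (x + 1).natAbs = n + 2 by omega, show (x - 1).natAbs = n by omega, add_comm]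

/-- Positive eigenfunctions of the weighted adjacency operator of the weighted Pascal
lattice: `A(0,1) = α`, `A(0,-1) = β`, `A(x,x±1) = 1` for `x ≠ 0`, `A = 0` otherwise.
(i) If `γ = (α+β)/2 < 1`, then `ψ(x) = 1 + (1/γ - 1)|x| > 0` and `Σ_y A(x,y)ψ(y) = 2ψ(x)`.
(ii) If `γ > 1`, then with `s = (1/2)√(1-(1-1/γ)²)`, `ρ = 1/s`, `q = 1/(2γs)`, one has
`0 < q < 1` and `ψ(x) = q^{|x|}` satisfies `Σ_y A(x,y)ψ(y) = ρ ψ(x)`. -/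
theorem weighted_pascal_eigenfunctions (α β : ℝ) (hα : 0 < α) (hβ : 0 < β)
    (γ : ℝ) (hγ : γ = (α + β) / 2)
    (A : ℤ → ℤ → ℝ)
    (hA : ∀ x y : ℤ, A x y =
      if x = 0 ∧ y = 1 then α
      else if x = 0 ∧ y = -1 then β
      else if x ≠ 0 ∧ (y = x + 1 ∨ y = x - 1) then 1
      else 0) :
    (γ < 1 →
      (∀ x : ℤ, 0 < 1 + (1 / γ - 1) * (x.natAbs : ℝ)) ∧
      ∀ x : ℤ, HasSum (fun y : ℤ => A x y * (1 + (1 / γ - 1) * (y.natAbs : ℝ)))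
        (2 * (1 + (1 / γ - 1) * (x.natAbs : ℝ)))) ∧
    (1 < γ →
      ∀ s ρ q : ℝ,
        s = 1 / 2 * Real.sqrt (1 - (1 - 1 / γ) ^ 2) → ρ = 1 / s → q = 1 / (2 * γ * s) →
        (0 < q ∧ q < 1) ∧
        ∀ x : ℤ, HasSum (fun y : ℤ => A x y * q ^ y.natAbs) (ρ * q ^ x.natAbs)) := by
  have hγ0 : 0 < γ := by linarith
  have hαβ : α + β = 2 * γ := by linarith
  refine ⟨fun hlt => ⟨fun x => ?_, ?_⟩, ?_⟩
  · have : 1 < 1 / γ := (one_lt_div hγ0).2 hlt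
    have : 0 ≤ (1 / γ - 1) * (x.natAbs : ℝ) := mul_nonneg (by linarith) (Nat.cast_nonneg _)
    linarith
  · refine hasSum_weighted_adjacency_of_recurrence
      (g := fun n => 1 + (1 / γ - 1) * (n : ℝ)) hA ?_ fun n => ?_
    · rw [hαβ]
      field_simp
      push_cast
      ring
    · push_cast
      ring
  · intro hlt s ρ q hs hρ hq
    have hrad : 1 - (1 - 1 / γ) ^ 2 = (2 * γ - 1) / γ ^ 2 := by
      field_simp
      ring
    rw [hrad, Real.sqrt_div' _ (sq_nonneg γ), Real.sqrt_sq hγ0.le] at hs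
    set r := Real.sqrt (2 * γ - 1)
    have hr1 : 1 < r := Real.lt_sqrt_of_sq_lt (by linarith)
    have hr0 : 0 < r := by linarith
    have hrsq : r ^ 2 = 2 * γ - 1 := Real.sq_sqrt (by linarith)
    have hqr : q = 1 / r := by
      rw [hq, hs]
      field_simp
    have hρr : ρ = 2 * γ / r := by
      rw [hρ, hs]
      field_simp
    refine ⟨⟨?_, ?_⟩, hasSum_weighted_adjacency_of_recurrence
      (g := fun n => q ^ n) hA ?_ fun n => ?_⟩
    · rw [hqr]
      positivity
    · rw [hqr]
      exact (div_lt_one hr0).2 hr1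
    · rw [hαβ, hρr, hqr]
      ring
    · have hrec : 1 + q ^ 2 = ρ * q := by
        rw [hρr, hqr]
        field_simp
        linarith
      linear_combination q ^ n * hrec
end

section
/- Let α, β > 0, γ = (α+β)/2, and let A : ℤ × ℤ → ℝ be as follows: A(0,1) = α, A(0,−1) = β, A(x,x+1) = A(x,x−1) = 1 for x ≠ 0, and A(x,y) = 0 otherwise. For n ≥ 0 and x ∈ ℤ let a_n(x) = Σ_{y∈ℤ} Aⁿ(x,y) be the total weight of n-step paths starting from x (a finite sum). Set z₀ = 1/2 if γ ≤ 1 and z₀ = (1/2)·√(1 − (1 − 1/γ)²) if γ > 1. Then for every x ∈ ℤ and every real z with 0 < z < z₀, the series Σ_{n≥0} a_n(x) zⁿ converges and equals 1/(1−2z) − (2(1−γ)z/(1−2z)) · R(z)^{|x|} / (1 − 2γz·R(z)), where R(z) = (1 − √(1−4z²))/(2z). -/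
open Finset Filter Topology

/-- The weighted adjacency operator of the Pascal lattice, acting on functions on `ℤ`. -/
def pascalOperator (α β : ℝ) (g : ℤ → ℝ) (x : ℤ) : ℝ :=
  if x = 0 then α * g 1 + β * g (-1) else g (x + 1) + g (x - 1)

theorem pascalOperator_mono {α β : ℝ} (hα : 0 ≤ α) (hβ : 0 ≤ β) {g h : ℤ → ℝ}
    (hgh : ∀ x, g x ≤ h x) (x : ℤ) : pascalOperator α β g x ≤ pascalOperator α β h x := by
  unfold pascalOperator
  split_ifs
  · exact add_le_add (mul_le_mul_of_nonneg_left (hgh _) hα) (mul_le_mul_of_nonneg_left (hgh _) hβ)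
  · exact add_le_add (hgh _) (hgh _)

theorem pascalOperator_nonneg {α β : ℝ} (hα : 0 ≤ α) (hβ : 0 ≤ β) {g : ℤ → ℝ}
    (hg : ∀ x, 0 ≤ g x) (x : ℤ) : 0 ≤ pascalOperator α β g x := by
  simpa [pascalOperator] using pascalOperator_mono hα hβ (g := fun _ => 0) hg x

theorem pascalOperator_sub (α β : ℝ) (g h : ℤ → ℝ) (x : ℤ) :
    pascalOperator α β (fun y => g y - h y) x =
      pascalOperator α β g x - pascalOperator α β h x := by
  unfold pascalOperator
  split_ifs <;> ring

theorem pascalOperator_const_mul (α β c : ℝ) (g : ℤ → ℝ) (x : ℤ) :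
    pascalOperator α β (fun y => c * g y) x = c * pascalOperator α β g x := by
  unfold pascalOperator
  split_ifs <;> ring

theorem pascalOperator_sum {ι : Type*} (α β : ℝ) (s : Finset ι) (g : ι → ℤ → ℝ) (x : ℤ) :
    pascalOperator α β (fun y => ∑ i ∈ s, g i y) x = ∑ i ∈ s, pascalOperator α β (g i) x := by
  unfold pascalOperator
  split_ifs <;> simp only [mul_sum, sum_add_distrib]

/-- Summing against the weighted adjacency matrix is the action of `pascalOperator`. -/
theorem finsum_adjacency_mul_eq_pascalOperator (α β : ℝ) (A : ℤ → ℤ → ℝ)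
    (hA : ∀ x y : ℤ, A x y =
      if x = 0 ∧ y = 1 then α
      else if x = 0 ∧ y = -1 then β
      else if x ≠ 0 ∧ (y = x + 1 ∨ y = x - 1) then 1
      else 0)
    (g : ℤ → ℝ) (x : ℤ) : ∑ᶠ y : ℤ, A x y * g y = pascalOperator α β g x := by
  have hsupp : (Function.support fun y => A x y * g y) ⊆ (({x + 1, x - 1} : Finset ℤ) : Set ℤ) := by
    intro y hy
    by_contra hmem
    simp only [coe_insert, coe_singleton, Set.mem_insert_iff, Set.mem_singleton_iff,
      not_or] at hmem
    apply hy
    have hzero : A x y = 0 := by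
      rw [hA, if_neg (by omega), if_neg (by omega), if_neg (by omega)]
    simp [hzero]
  rw [finsum_eq_sum_of_support_subset _ hsupp, sum_pair (by omega), hA, hA, pascalOperator]
  by_cases hx : x = 0
  · subst hx
    norm_num
  · simp [hx]

/-- If `f` is a nonnegative bounded solution of `f = 1 + z A f`, then the series `∑ zⁿ Aⁿ 1`
converges to `f`. -/
theorem hasSum_of_pascalOperator_fixed_point {α β z M : ℝ} (hα : 0 ≤ α) (hβ : 0 ≤ β) (hz : 0 ≤ z)
    {a : ℕ → ℤ → ℝ} (ha0 : ∀ x, a 0 x = 1)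
    (ha : ∀ n x, a (n + 1) x = pascalOperator α β (a n) x)
    {f : ℤ → ℝ} (hf0 : ∀ x, 0 ≤ f x) (hfM : ∀ x, f x ≤ M)
    (hf : ∀ x, f x = 1 + z * pascalOperator α β f x) (x : ℤ) :
    HasSum (fun n => a n x * z ^ n) (f x) := by
  have ha_nonneg : ∀ n x, 0 ≤ a n x := by
    intro n
    induction n with
    | zero => intro x; simp [ha0]
    | succ n ih => intro x; rw [ha]; exact pascalOperator_nonneg hα hβ ih x
  have hM : 1 ≤ M := by
    have h := mul_nonneg hz (pascalOperator_nonneg hα hβ hf0 0)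
    linarith [hf 0, hfM 0]
  have hM0 : 0 < M := by linarith
  set ρ : ℝ := 1 - 1 / M with hρ
  have hinv : 1 / M ≤ 1 := (div_le_one hM0).2 hM
  have hinv0 : 0 < 1 / M := by positivity
  have hρ0 : 0 ≤ ρ := by linarith
  have hρ1 : ρ < 1 := by linarith
  have hcontract : ∀ x, z * pascalOperator α β f x ≤ ρ * f x := by
    intro x
    have h : 1 / M * f x ≤ 1 := by
      rw [one_div_mul_eq_div]
      exact (div_le_one hM0).2 (hfM x)
    have := hf x
    rw [hρ]
    linarith
  have hpartial : ∀ N x, ∑ n ∈ range (N + 1), a n x * z ^ n =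
      1 + z * pascalOperator α β (fun y => ∑ n ∈ range N, a n y * z ^ n) x := by
    intro N x
    rw [sum_range_succ', pascalOperator_sum, mul_sum, ha0, add_comm]
    congr 1
    · simp
    · refine sum_congr rfl fun n _ => ?_
      simp only [mul_comm (a n _)]
      rw [pascalOperator_const_mul, ha]
      ring
  have herror : ∀ N x, 0 ≤ f x - ∑ n ∈ range N, a n x * z ^ n ∧
      f x - ∑ n ∈ range N, a n x * z ^ n ≤ ρ ^ N * f x := by
    intro N
    induction N with
    | zero => intro x; simpa using hf0 x
    | succ N ih =>
      intro x
      have hstep : f x - ∑ n ∈ range (N + 1), a n x * z ^ n =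
          z * pascalOperator α β (fun y => f y - ∑ n ∈ range N, a n y * z ^ n) x := by
        rw [hpartial, pascalOperator_sub]
        linarith [hf x]
      rw [hstep]
      refine ⟨mul_nonneg hz (pascalOperator_nonneg hα hβ (fun y => (ih y).1) x), ?_⟩
      calc z * pascalOperator α β (fun y => f y - ∑ n ∈ range N, a n y * z ^ n) x
          ≤ z * pascalOperator α β (fun y => ρ ^ N * f y) x :=
            mul_le_mul_of_nonneg_left (pascalOperator_mono hα hβ (fun y => (ih y).2) x) hz
        _ = ρ ^ N * (z * pascalOperator α β f x) := by
            rw [pascalOperator_const_mul]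
            ring
        _ ≤ ρ ^ N * (ρ * f x) := mul_le_mul_of_nonneg_left (hcontract x) (pow_nonneg hρ0 N)
        _ = ρ ^ (N + 1) * f x := by ring
  rw [hasSum_iff_tendsto_nat_of_nonneg
    (fun n => mul_nonneg (ha_nonneg n x) (pow_nonneg hz n))]
  have hgeom : Tendsto (fun N : ℕ => ρ ^ N * f x) atTop (𝓝 0) := by
    simpa using (tendsto_pow_atTop_nhds_zero_of_lt_one hρ0 hρ1).mul_const (f x)
  have hdiff := squeeze_zero (fun N => (herror N x).1) (fun N => (herror N x).2) hgeom
  simpa using hdiff.const_sub (f x)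

/-- The closed form of the generating function solves `f = 1 + z A f`, for any root `R` of
`z R² - R + z = 0`. -/
theorem pascalOperator_closed_form {α β γ z R : ℝ} (hγ : γ = (α + β) / 2)
    (hz : 1 - 2 * z ≠ 0) (hD : 1 - 2 * γ * z * R ≠ 0) (hR : z * R ^ 2 + z = R) (x : ℤ) :
    1 / (1 - 2 * z) - 2 * (1 - γ) * z / (1 - 2 * z) * R ^ x.natAbs / (1 - 2 * γ * z * R) =
      1 + z * pascalOperator α β (fun y => 1 / (1 - 2 * z) -
        2 * (1 - γ) * z / (1 - 2 * z) * R ^ y.natAbs / (1 - 2 * γ * z * R)) x := by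
  unfold pascalOperator
  split_ifs with hx
  · subst hx
    have hβ : β = 2 * γ - α := by linarith
    subst hβ
    simp only [Int.natAbs_zero, Int.natAbs_one, Int.natAbs_neg, pow_zero, pow_one]
    have hD_comm : 1 - 2 * z * γ * R ≠ 0 := by rwa [mul_right_comm 2 z γ]
    field_simp
    ring
  · obtain ⟨k, hk⟩ : ∃ k, x.natAbs = k + 1 := ⟨x.natAbs - 1, by omega⟩
    have hpow : z * (R ^ (x + 1).natAbs + R ^ (x - 1).natAbs) = R ^ x.natAbs := by
      have hsplit : ((x + 1).natAbs = k + 2 ∧ (x - 1).natAbs = k) ∨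
          ((x + 1).natAbs = k ∧ (x - 1).natAbs = k + 2) := by omega
      rcases hsplit with ⟨h₁, h₂⟩ | ⟨h₁, h₂⟩ <;> rw [h₁, h₂, hk] <;>
        linear_combination R ^ k * hR
    rw [← hpow]
    field_simp
    ring

/-- Generating function of the total weight of `n`-step walks on `ℤ` for the weighted
Pascal lattice: with `A(0,1) = α`, `A(0,-1) = β`, `A(x,x±1) = 1` for `x ≠ 0`,
`a_0 ≡ 1`, `a_{n+1}(x) = Σ_y A(x,y) a_n(y)` (so `a_n(x) = Σ_y Aⁿ(x,y)`), and
`γ = (α+β)/2`, for every `x ∈ ℤ` and `0 < z < z₀` the series `Σ_n a_n(x) zⁿ`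
converges to `1/(1-2z) - (2(1-γ)z/(1-2z)) R(z)^{|x|}/(1-2γz R(z))`,
where `R(z) = (1-√(1-4z²))/(2z)`. -/
theorem weighted_pascal_generating_function (α β : ℝ) (hα : 0 < α) (hβ : 0 < β)
    (γ : ℝ) (hγ : γ = (α + β) / 2)
    (A : ℤ → ℤ → ℝ)
    (hA : ∀ x y : ℤ, A x y =
      if x = 0 ∧ y = 1 then α
      else if x = 0 ∧ y = -1 then β
      else if x ≠ 0 ∧ (y = x + 1 ∨ y = x - 1) then 1
      else 0)
    (a : ℕ → ℤ → ℝ) (ha0 : ∀ x : ℤ, a 0 x = 1)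
    (ha : ∀ (n : ℕ) (x : ℤ), a (n + 1) x = ∑ᶠ y : ℤ, A x y * a n y)
    (z₀ : ℝ)
    (hz₀ : z₀ = if γ ≤ 1 then 1 / 2 else 1 / 2 * Real.sqrt (1 - (1 - 1 / γ) ^ 2)) :
    ∀ (x : ℤ) (z : ℝ), 0 < z → z < z₀ →
      HasSum (fun n : ℕ => a n x * z ^ n)
        (1 / (1 - 2 * z) -
          2 * (1 - γ) * z / (1 - 2 * z) *
            ((1 - Real.sqrt (1 - 4 * z ^ 2)) / (2 * z)) ^ x.natAbs /
            (1 - 2 * γ * z * ((1 - Real.sqrt (1 - 4 * z ^ 2)) / (2 * z)))) := by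
  intro x z hz hzz₀
  have hγ0 : 0 < γ := by rw [hγ]; linarith
  have hz_half : z < 1 / 2 := by
    refine hzz₀.trans_le ?_
    rw [hz₀]
    split_ifs
    · exact le_rfl
    · have : √(1 - (1 - 1 / γ) ^ 2) ≤ 1 :=
        Real.sqrt_le_one.2 (by linarith [sq_nonneg (1 - 1 / γ)])
      linarith
  have hsq : 0 < 1 - 4 * z ^ 2 := by nlinarith
  set s := √(1 - 4 * z ^ 2) with hs
  have hs0 : 0 < s := Real.sqrt_pos.2 hsq
  have hss : s ^ 2 = 1 - 4 * z ^ 2 := Real.sq_sqrt hsq.le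
  set R := (1 - s) / (2 * z) with hRdef
  have hzR : 2 * z * R = 1 - s := by rw [hRdef]; field_simp
  have hs1 : s < 1 := by nlinarith
  have hR0 : 0 < R := div_pos (by linarith) (by linarith)
  have hR1 : R < 1 := by
    rw [hRdef, div_lt_one (by linarith)]
    nlinarith
  have hRquad : z * R ^ 2 + z = R := by
    have h : 4 * z * (z * R ^ 2 + z) = 4 * z * R := by
      linear_combination (2 * z * R + 1 - s - 2) * hzR + hss
    exact mul_left_cancel₀ (by positivity) h
  have hD : 0 < 1 - 2 * γ * z * R := by
    have hrw : 1 - 2 * γ * z * R = 1 - γ * (1 - s) := by linear_combination -γ * hzR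
    rw [hrw]
    rcases le_or_gt γ 1 with h | h
    · nlinarith
    · rw [hz₀, if_neg (not_le.2 h)] at hzz₀
      have hlt : 2 * z < √(1 - (1 - 1 / γ) ^ 2) := by linarith
      rw [Real.lt_sqrt (by linarith)] at hlt
      have hs_lower : 1 - 1 / γ < s := by
        rw [hs]
        exact Real.lt_sqrt_of_sq_lt (by linarith)
      have hmul := mul_lt_mul_of_pos_left hs_lower hγ0
      have hcancel : γ * (1 / γ) = 1 := mul_one_div_cancel hγ0.ne'
      linarith
  have hz2 : 0 < 1 - 2 * z := by linarith
  have hpow1 : ∀ y : ℤ, R ^ y.natAbs ≤ 1 := fun y => pow_le_one₀ hR0.le hR1.le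
  have hpow0 : ∀ y : ℤ, 0 ≤ R ^ y.natAbs := fun y => pow_nonneg hR0.le _
  refine hasSum_of_pascalOperator_fixed_point
    (M := 1 / (1 - 2 * z) + |2 * (1 - γ) * z / (1 - 2 * z)| / (1 - 2 * γ * z * R))
    (f := fun y => 1 / (1 - 2 * z) -
      2 * (1 - γ) * z / (1 - 2 * z) * R ^ y.natAbs / (1 - 2 * γ * z * R))
    hα.le hβ.le hz.le ha0
    (fun n x => by rw [ha, finsum_adjacency_mul_eq_pascalOperator α β A hA]) ?_ ?_
    (pascalOperator_closed_form hγ hz2.ne' hD.ne' hRquad) x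
  · intro y
    have hD_comm : 1 - 2 * z * γ * R ≠ 0 := by rw [mul_right_comm 2 z γ]; exact hD.ne'
    have hrw : 1 / (1 - 2 * z) -
        2 * (1 - γ) * z / (1 - 2 * z) * R ^ y.natAbs / (1 - 2 * γ * z * R) =
        (1 - 2 * γ * z * R - 2 * (1 - γ) * z * R ^ y.natAbs) /
          ((1 - 2 * z) * (1 - 2 * γ * z * R)) := by
      field_simp
    rw [hrw]
    refine div_nonneg ?_ (by positivity)
    rcases le_or_gt γ 1 with h | h
    · have h₁ : (1 - γ) * z * R ^ y.natAbs ≤ (1 - γ) * z * 1 :=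
        mul_le_mul_of_nonneg_left (hpow1 y) (mul_nonneg (by linarith) hz.le)
      have h₂ : γ * z * R ≤ γ * z * 1 := mul_le_mul_of_nonneg_left hR1.le (by positivity)
      linarith
    · have h₁ : 0 ≤ (γ - 1) * z * R ^ y.natAbs :=
        mul_nonneg (mul_nonneg (by linarith) hz.le) (hpow0 y)
      linarith
  · intro y
    have hbound : -(2 * (1 - γ) * z / (1 - 2 * z) * R ^ y.natAbs) ≤
        |2 * (1 - γ) * z / (1 - 2 * z)| := by
      refine (neg_le_abs _).trans ?_
      rw [abs_mul, abs_of_nonneg (hpow0 y)]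
      exact mul_le_of_le_one_right (abs_nonneg _) (hpow1 y)
    have hdiv := div_le_div_of_nonneg_right hbound hD.le
    rw [neg_div] at hdiv
    linarith
end
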